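/- arXiv:2103.01286 — 2 statements merged into one kernel-verified Lean document; each statement's English description precedes it below -/
import Mathlib

section
/- Let (h, q, q₁, q₂, q₃) be smooth functions on ℝ^d × (0,∞) with h > 0, v := q/h, satisfying the constraints q₁ = h² and q₃ = q·∇z, and satisfying the first-order system ∂_t h + div q = 0; ∂_t q + div(v ⊗ q) + ∇((1/2)g h² − (1/3) h s) = −(g h − (1/2)s + (1/4)ts)∇z; ∂_t q₁ + div(v q₁) = q₂ − (3/2) q₃; ∂_t q₂ + div(v q₂) = −s; ∂_t q₃ + div(v q₃) = ts, where ts := ∂_t q₃ + div(v q₃) and s := −(∂_t q₂ + div(v q₂)). Then (h, q) is a solution of the dispersive Serre–Green–Naghdi model with topography, i.e., ∂_t h + div q = 0 and ∂_t q + div(v ⊗ q) + ∇p + r ∇z = 0, with p := (1/2)g h² + h²((1/3)ḧ + (1/2)k̇) and r := g h + h((1/2)ḧ + k̇). -/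
noncomputable section
open scoped BigOperators

/-- Physical space `ℝ^d`. -/
abbrev Spc (d : ℕ) := EuclideanSpace ℝ (Fin d)
/-- Space-time `ℝ^d × ℝ` (time is the second component). -/
abbrev SpT (d : ℕ) := Spc d × ℝ

/-- Time derivative `∂_t f`. -/
noncomputable def dT {d : ℕ} (f : SpT d → ℝ) (p : SpT d) : ℝ :=
  deriv (fun t => f (p.1, t)) p.2

/-- `i`-th spatial partial derivative `∂_i f` of a space-time function. -/
noncomputable def dX {d : ℕ} (i : Fin d) (f : SpT d → ℝ) (p : SpT d) : ℝ :=
  fderiv ℝ (fun x => f (x, p.2)) p.1 (EuclideanSpace.single i 1)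

/-- `i`-th spatial partial derivative `∂_i z` of a time-independent function. -/
noncomputable def dZ {d : ℕ} (i : Fin d) (z : Spc d → ℝ) (x : Spc d) : ℝ :=
  fderiv ℝ z x (EuclideanSpace.single i 1)

/-- Divergence `div u = ∑_i ∂_i u_i` of a vector field. -/
noncomputable def divF {d : ℕ} (u : SpT d → Spc d) (p : SpT d) : ℝ :=
  ∑ i, dX i (fun q => u q i) p

/-- Divergence `div (f v) = ∑_i ∂_i (v_i f)` of a scalar multiple of a vector field. -/
noncomputable def divSV {d : ℕ} (v : SpT d → Spc d) (f : SpT d → ℝ) (p : SpT d) : ℝ :=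
  ∑ i, dX i (fun q => v q i * f q) p

/-- Advection term `v·∇f`. -/
noncomputable def adv {d : ℕ} (v : SpT d → Spc d) (f : SpT d → ℝ) (p : SpT d) : ℝ :=
  ∑ i, v p i * dX i f p

/-- `v·∇z` for the (time-independent) bathymetry `z`. -/
noncomputable def advZ {d : ℕ} (v : SpT d → Spc d) (z : Spc d → ℝ) (p : SpT d) : ℝ :=
  ∑ i, v p i * dZ i z p.1

/-- `dT` is local in time: it only sees the function on the half space `t > 0`. -/
theorem dT_congr_pos {d : ℕ} {f₁ f₂ : SpT d → ℝ} (H : ∀ p : SpT d, 0 < p.2 → f₁ p = f₂ p)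
    {p : SpT d} (hp : 0 < p.2) : dT f₁ p = dT f₂ p := by
  refine Filter.EventuallyEq.deriv_eq ?_
  filter_upwards [lt_mem_nhds hp] with t ht using H (p.1, t) ht

theorem dX_congr_pos {d : ℕ} {f₁ f₂ : SpT d → ℝ} (H : ∀ p : SpT d, 0 < p.2 → f₁ p = f₂ p)
    {p : SpT d} (hp : 0 < p.2) (i : Fin d) : dX i f₁ p = dX i f₂ p := by
  have key : (fun x => f₁ (x, p.2)) = fun x => f₂ (x, p.2) := funext fun x => H (x, p.2) hp
  rw [dX, dX, key]

theorem adv_congr_pos {d : ℕ} (v : SpT d → Spc d) {f₁ f₂ : SpT d → ℝ}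
    (H : ∀ p : SpT d, 0 < p.2 → f₁ p = f₂ p) {p : SpT d} (hp : 0 < p.2) :
    adv v f₁ p = adv v f₂ p :=
  Finset.sum_congr rfl fun i _ => by rw [dX_congr_pos H hp i]

theorem dT_mul {d : ℕ} {f₁ f₂ : SpT d → ℝ} (h₁ : Differentiable ℝ f₁) (h₂ : Differentiable ℝ f₂)
    (p : SpT d) : dT (fun q => f₁ q * f₂ q) p = dT f₁ p * f₂ p + f₁ p * dT f₂ p :=
  deriv_fun_mul (by fun_prop) (by fun_prop)

theorem dX_mul {d : ℕ} {f₁ f₂ : SpT d → ℝ} (h₁ : Differentiable ℝ f₁) (h₂ : Differentiable ℝ f₂)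
    (i : Fin d) (p : SpT d) :
    dX i (fun q => f₁ q * f₂ q) p = dX i f₁ p * f₂ p + f₁ p * dX i f₂ p := by
  unfold dX
  rw [fderiv_fun_mul (by fun_prop) (by fun_prop)]
  simp
  ring

theorem dT_sub_const_mul {d : ℕ} {f₁ f₂ : SpT d → ℝ} (h₁ : Differentiable ℝ f₁)
    (h₂ : Differentiable ℝ f₂) (c : ℝ) (p : SpT d) :
    dT (fun q => f₁ q - c * f₂ q) p = dT f₁ p - c * dT f₂ p := by
  unfold dT
  rw [deriv_fun_sub (by fun_prop) (by fun_prop), deriv_const_mul _ (by fun_prop)]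

theorem dX_sub_const_mul {d : ℕ} {f₁ f₂ : SpT d → ℝ} (h₁ : Differentiable ℝ f₁)
    (h₂ : Differentiable ℝ f₂) (c : ℝ) (i : Fin d) (p : SpT d) :
    dX i (fun q => f₁ q - c * f₂ q) p = dX i f₁ p - c * dX i f₂ p := by
  unfold dX
  rw [fderiv_fun_sub (by fun_prop) (by fun_prop), fderiv_const_mul (by fun_prop)]
  simp

theorem adv_sub_const_mul {d : ℕ} (v : SpT d → Spc d) {f₁ f₂ : SpT d → ℝ}
    (h₁ : Differentiable ℝ f₁) (h₂ : Differentiable ℝ f₂) (c : ℝ) (p : SpT d) :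
    adv v (fun q => f₁ q - c * f₂ q) p = adv v f₁ p - c * adv v f₂ p := by
  unfold adv
  rw [Finset.mul_sum, ← Finset.sum_sub_distrib]
  refine Finset.sum_congr rfl fun i _ => ?_
  rw [dX_sub_const_mul h₁ h₂]
  ring

/-- Under conservation of mass, `∂_t (h f) + div (v h f) = h (∂_t f + v·∇f)`. -/
theorem dT_add_divSV_of_mass {d : ℕ} {h f F : SpT d → ℝ} {Q v : SpT d → Spc d}
    (hh : Differentiable ℝ h) (hQ : Differentiable ℝ Q) (hf : Differentiable ℝ f)
    (hpos : ∀ p, 0 < h p) (hv : ∀ p, v p = (h p)⁻¹ • Q p) (hF : ∀ p, F p = h p * f p)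
    {p : SpT d} (mass : dT h p + divF Q p = 0) :
    dT F p + divSV v F p = h p * (dT f p + adv v f p) := by
  obtain rfl : F = fun q => h q * f q := funext hF
  have hflux : ∀ i, (fun q => v q i * (h q * f q)) = fun q => Q q i * f q := fun i => by
    funext q
    have := (hpos q).ne'
    simp only [hv, PiLp.smul_apply, smul_eq_mul]
    field_simp
  have hdiv : divSV v (fun q => h q * f q) p = divF Q p * f p + h p * adv v f p := by
    unfold divSV divF adv
    rw [Finset.sum_mul, Finset.mul_sum, ← Finset.sum_add_distrib]
    refine Finset.sum_congr rfl fun i _ => ?_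
    have := (hpos p).ne'
    rw [hflux, dX_mul (by fun_prop) hf, hv]
    simp only [PiLp.smul_apply, smul_eq_mul]
    field_simp
  rw [hdiv, dT_mul hh hf]
  linear_combination f p * mass

/-- Smooth functions `(h, q, q₁, q₂, q₃)` with `h > 0` satisfying the
constraints `q₁ = h²`, `q₃ = q·∇z` and the first-order system (with `ts := ∂_t q₃ + div(v q₃)`
and `s := -(∂_t q₂ + div(v q₂))`) yield a solution `(h, q)` of the dispersive
Serre--Green--Naghdi model with topography. -/
theorem sgn_first_order_implies_sgn
    {d : ℕ} (g : ℝ) (hg : 0 < g)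
    (z : Spc d → ℝ) (zsm : ContDiff ℝ (⊤ : ℕ∞) z)
    (h : SpT d → ℝ) (Q : SpT d → Spc d) (q₁ q₂ q₃ : SpT d → ℝ)
    (hsm : ContDiff ℝ (⊤ : ℕ∞) h) (Qsm : ContDiff ℝ (⊤ : ℕ∞) Q)
    (q₁sm : ContDiff ℝ (⊤ : ℕ∞) q₁) (q₂sm : ContDiff ℝ (⊤ : ℕ∞) q₂) (q₃sm : ContDiff ℝ (⊤ : ℕ∞) q₃)
    (hpos : ∀ p : SpT d, 0 < h p)
    (v : SpT d → Spc d) (hv : ∀ p, v p = (h p)⁻¹ • Q p)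
    -- `ts := ∂_t q₃ + div(v q₃)` and `s := -(∂_t q₂ + div(v q₂))`
    (ts s : SpT d → ℝ)
    (hts : ∀ p, ts p = dT q₃ p + divSV v q₃ p)
    (hs : ∀ p, s p = -(dT q₂ p + divSV v q₂ p))
    -- the constraints
    (cons₁ : ∀ p : SpT d, q₁ p = (h p)^2)
    (cons₃ : ∀ p : SpT d, q₃ p = ∑ i, Q p i * dZ i z p.1)
    -- the first-order system on `ℝ^d × (0,∞)`
    (mass : ∀ p : SpT d, 0 < p.2 → dT h p + divF Q p = 0)
    (momentum : ∀ p : SpT d, 0 < p.2 → ∀ i : Fin d,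
      dT (fun q => Q q i) p + (∑ j, dX j (fun q => v q j * Q q i) p)
        + dX i (fun q => (1/2) * g * (h q)^2 - (1/3) * h q * s q) p
        + (g * h p - (1/2) * s p + (1/4) * ts p) * dZ i z p.1 = 0)
    (eqq₁ : ∀ p : SpT d, 0 < p.2 → dT q₁ p + divSV v q₁ p = q₂ p - (3/2) * q₃ p)
    (eqq₂ : ∀ p : SpT d, 0 < p.2 → dT q₂ p + divSV v q₂ p = -(s p))
    (eqq₃ : ∀ p : SpT d, 0 < p.2 → dT q₃ p + divSV v q₃ p = ts p)
    -- material derivatives, pressure and source of the Serre--Green--Naghdi model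
    (hdot : SpT d → ℝ) (hhdot : ∀ p, hdot p = dT h p + adv v h p)
    (hddot : SpT d → ℝ) (hhddot : ∀ p, hddot p = dT hdot p + adv v hdot p)
    (kdot : SpT d → ℝ)
    (hkdot : ∀ p, kdot p = dT (fun q => advZ v z q) p + adv v (fun q => advZ v z q) p)
    (P : SpT d → ℝ)
    (hP : ∀ p, P p = (1/2) * g * (h p)^2 + (h p)^2 * ((1/3) * hddot p + (1/2) * kdot p))
    (R : SpT d → ℝ)
    (hR : ∀ p, R p = g * h p + h p * ((1/2) * hddot p + kdot p)) :
    -- then `(h, q)` solves the dispersive Serre--Green--Naghdi model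
    (∀ p : SpT d, 0 < p.2 → dT h p + divF Q p = 0) ∧
    (∀ p : SpT d, 0 < p.2 → ∀ i : Fin d,
      dT (fun q => Q q i) p + (∑ j, dX j (fun q => v q j * Q q i) p)
        + dX i P p + R p * dZ i z p.1 = 0) := by
  refine ⟨mass, fun p hp i => ?_⟩
  have hne : ∀ p, h p ≠ 0 := fun p => (hpos p).ne'
  have hd : Differentiable ℝ h := hsm.differentiable (by simp)
  have Qd : Differentiable ℝ Q := Qsm.differentiable (by simp)
  have q₂d : Differentiable ℝ q₂ := q₂sm.differentiable (by simp)
  have zd : ∀ i, Differentiable ℝ (dZ i z) := fun i =>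
    ((zsm.fderiv_right (m := (⊤ : ℕ∞)) le_rfl).clm_apply
      contDiff_const).differentiable (by simp)
  have wd : Differentiable ℝ (fun q => advZ v z q) := by
    have key : (fun q => advZ v z q) = fun q => ∑ i, ((h q)⁻¹ * Q q i) * dZ i z q.1 := by
      funext q
      simp [advZ, hv]
    rw [key]
    have := hd.fun_inv hne
    fun_prop
  have hq₃ : ∀ p, q₃ p = h p * advZ v z p := fun p => by
    rw [cons₃, advZ, Finset.mul_sum]
    refine Finset.sum_congr rfl fun i _ => ?_
    have := hne p
    simp only [hv, PiLp.smul_apply, smul_eq_mul]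
    field_simp
  obtain ⟨f, fd, hf⟩ : ∃ f : SpT d → ℝ, Differentiable ℝ f ∧ ∀ p, q₂ p = h p * f p := by
    refine ⟨fun q => q₂ q * (h q)⁻¹, q₂d.mul (hd.fun_inv hne), fun p => ?_⟩
    have := hne p
    field_simp
  have hhdot_eq : ∀ p : SpT d, 0 < p.2 → hdot p = f p - 3 / 2 * advZ v z p := fun p hp => by
    have e := eqq₁ p hp
    rw [dT_add_divSV_of_mass hd Qd hd hpos hv (fun p => by rw [cons₁, sq]) (mass p hp),
      ← hhdot, hf, hq₃] at e
    exact mul_left_cancel₀ (hne p) (by linear_combination e)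
  have hts_eq : ∀ p : SpT d, 0 < p.2 → ts p = h p * kdot p := fun p hp => by
    rw [hts, dT_add_divSV_of_mass hd Qd wd hpos hv hq₃ (mass p hp), hkdot]
  have hs_eq : ∀ p : SpT d, 0 < p.2 → s p = -(h p * (hddot p + 3 / 2 * kdot p)) := fun p hp => by
    rw [hs, dT_add_divSV_of_mass hd Qd fd hpos hv hf (mass p hp), hhddot, hkdot,
      dT_congr_pos hhdot_eq hp, adv_congr_pos v hhdot_eq hp, dT_sub_const_mul fd wd,
      adv_sub_const_mul v fd wd]
    ring
  have hP_eq : ∀ p : SpT d, 0 < p.2 →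
      P p = (1/2) * g * (h p)^2 - (1/3) * h p * s p := fun p hp => by
    rw [hP, hs_eq p hp]
    ring
  rw [dX_congr_pos hP_eq hp, hR]
  have e := momentum p hp i
  rw [hts_eq p hp, hs_eq p hp] at e
  linear_combination e
end
end

section
/- Let (h, q, q₁, q₂, q₃) be a smooth solution of the relaxed Serre–Green–Naghdi system with h > 0. Define E_ε := (1/2)g(h+z)² + (1/2)h|v|² + (1/6)h ω² + (1/8)h β² + (λ̄ g/(3ε)) h³ Γ(η/h) and F_ε := v(E_ε − (1/2)g z² + p_ε). Then ∂_t E_ε + div F_ε = (1/4) ts_ε (β − v·∇z), and this right-hand side is ≤ 0. -/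
noncomputable section
open scoped BigOperators

/-- The time derivative is the Fréchet derivative in the direction `(0, 1)`. -/
theorem dT_eq_fderiv {d : ℕ} {f : SpT d → ℝ} {p : SpT d} (hf : DifferentiableAt ℝ f p) :
    dT f p = fderiv ℝ f p (0, 1) := by
  have hc : HasDerivAt (fun t : ℝ => ((p.1, t) : SpT d)) (0, 1) p.2 :=
    (hasDerivAt_const p.2 p.1).prodMk (hasDerivAt_id p.2)
  exact (HasFDerivAt.comp_hasDerivAt (l := f) p.2 hf.hasFDerivAt hc).deriv

/-- A spatial partial derivative is the Fréchet derivative in the direction `(e_i, 0)`. -/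
theorem dX_eq_fderiv {d : ℕ} {f : SpT d → ℝ} {p : SpT d} (i : Fin d)
    (hf : DifferentiableAt ℝ f p) :
    dX i f p = fderiv ℝ f p (EuclideanSpace.single i 1, 0) := by
  have hc : HasFDerivAt (fun x : Spc d => ((x, p.2) : SpT d))
      ((ContinuousLinearMap.id ℝ (Spc d)).prod 0) p.1 :=
    (hasFDerivAt_id p.1).prodMk (hasFDerivAt_const p.2 p.1)
  have hcomp := HasFDerivAt.comp (g := f) p.1 hf.hasFDerivAt hc
  exact congrArg (fun L => L (EuclideanSpace.single i 1)) hcomp.fderiv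

/-- A linear functional applied to a vector is the combination of its values on the
canonical basis. -/
theorem map_eq_sum_single {d : ℕ} (L : Spc d →L[ℝ] ℝ) (u : Spc d) :
    L u = ∑ i, u i * L (EuclideanSpace.single i 1) := by
  conv_lhs => rw [← (EuclideanSpace.basisFun (Fin d) ℝ).sum_repr u]
  simp [map_sum]

/-- The material derivative `∂_t f + v·∇f` is the Fréchet derivative in the direction `(v, 1)`. -/
theorem dT_add_adv {d : ℕ} {v : SpT d → Spc d} {f : SpT d → ℝ} {p : SpT d}
    (hf : DifferentiableAt ℝ f p) :
    dT f p + adv v f p = fderiv ℝ f p (v p, 1) := by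
  have hsum := map_eq_sum_single
    ((fderiv ℝ f p).comp (ContinuousLinearMap.inl ℝ (Spc d) ℝ)) (v p)
  simp only [ContinuousLinearMap.comp_apply, ContinuousLinearMap.inl_apply] at hsum
  have hsplit : ((v p, 1) : SpT d) = (0, 1) + (v p, 0) := by simp
  rw [hsplit, map_add, hsum, dT_eq_fderiv hf, adv]
  simp only [dX_eq_fderiv _ hf]

/-- The Leibniz rule `div (f v) = v·∇f + f div v`. -/
theorem divSV_eq {d : ℕ} {v : SpT d → Spc d} {f : SpT d → ℝ} {p : SpT d}
    (hv : ∀ i, DifferentiableAt ℝ (fun q => v q i) p) (hf : DifferentiableAt ℝ f p) :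
    divSV v f p = adv v f p + f p * divF v p := by
  simp only [divSV, adv, divF, Finset.mul_sum, ← Finset.sum_add_distrib]
  refine Finset.sum_congr rfl fun i _ => ?_
  rw [dX_eq_fderiv i ((hv i).fun_mul hf), dX_eq_fderiv i hf, dX_eq_fderiv i (hv i),
    ((hv i).hasFDerivAt.fun_mul hf.hasFDerivAt).fderiv]
  simp

/-- Conservative transport `∂_t f + div (f v)` in terms of the material derivative. -/
theorem dT_add_divSV {d : ℕ} {v : SpT d → Spc d} {f : SpT d → ℝ} {p : SpT d}
    (hv : ∀ i, DifferentiableAt ℝ (fun q => v q i) p) (hf : DifferentiableAt ℝ f p) :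
    dT f p + divSV v f p = fderiv ℝ f p (v p, 1) + f p * divF v p := by
  rw [divSV_eq hv hf, ← dT_add_adv hf]
  ring

/-- The material derivative of the bathymetry is `v·∇z`. -/
theorem fderiv_bathymetry {d : ℕ} {v : SpT d → Spc d} {z : Spc d → ℝ} {p : SpT d}
    (hz : DifferentiableAt ℝ z p.1) :
    fderiv ℝ (fun q : SpT d => z q.1) p (v p, 1) = advZ v z p := by
  have hcomp : HasFDerivAt (fun q : SpT d => z q.1)
      ((fderiv ℝ z p.1).comp (ContinuousLinearMap.fst ℝ (Spc d) ℝ)) p :=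
    HasFDerivAt.comp (g := z) p hz.hasFDerivAt hasFDerivAt_fst
  rw [hcomp.fderiv]
  exact map_eq_sum_single (fderiv ℝ z p.1) (v p)

/-- The restriction of a differentiable function to a line has the directional derivative as its
derivative. -/
theorem hasDerivAt_line {d : ℕ} {f : SpT d → ℝ} {p : SpT d} (w : SpT d)
    (hf : DifferentiableAt ℝ f p) :
    HasDerivAt (fun s : ℝ => f (p + s • w)) (fderiv ℝ f p w) 0 :=
  hf.hasFDerivAt.hasLineDerivAt w

/-- The directional Leibniz rule. -/
theorem fderiv_mul_apply {d : ℕ} {a b : SpT d → ℝ} {p : SpT d} (w : SpT d)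
    (ha : DifferentiableAt ℝ a p) (hb : DifferentiableAt ℝ b p) :
    fderiv ℝ (fun q => a q * b q) p w = fderiv ℝ a p w * b p + a p * fderiv ℝ b p w := by
  rw [(ha.hasFDerivAt.fun_mul hb.hasFDerivAt).fderiv]
  simp
  ring

/-- A quotient of differentiable functions on space-time is differentiable where the denominator
does not vanish. -/
theorem differentiableAt_quotient {d : ℕ} {a b : SpT d → ℝ} {p : SpT d}
    (ha : DifferentiableAt ℝ a p) (hb : DifferentiableAt ℝ b p) (hne : b p ≠ 0) :
    DifferentiableAt ℝ (fun q => a q / b q) p := by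
  simp only [div_eq_mul_inv]
  exact ha.fun_mul (hb.fun_inv hne)

/-- The directional derivative of `E_ε - g z² / 2`, with `E_ε` the relaxed energy. -/
theorem fderiv_energy {d : ℕ} {g K : ℝ} {Γ : ℝ → ℝ} {h ω β η b : SpT d → ℝ}
    {v : SpT d → Spc d} {p : SpT d} (w : SpT d) (hΓ : Differentiable ℝ Γ)
    (hpos : 0 < h p) (hh : DifferentiableAt ℝ h p) (hω : DifferentiableAt ℝ ω p)
    (hβ : DifferentiableAt ℝ β p) (hη : DifferentiableAt ℝ η p) (hb : DifferentiableAt ℝ b p)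
    (hv : ∀ i, DifferentiableAt ℝ (fun q => v q i) p) :
    DifferentiableAt ℝ (fun q => (1/2) * g * (h q)^2 + g * h q * b q
      + (1/2) * h q * (∑ i, (v q i)^2) + (1/6) * h q * (ω q)^2 + (1/8) * h q * (β q)^2
      + K * (h q)^3 * Γ (η q / h q)) p ∧
    fderiv ℝ (fun q => (1/2) * g * (h q)^2 + g * h q * b q
      + (1/2) * h q * (∑ i, (v q i)^2) + (1/6) * h q * (ω q)^2 + (1/8) * h q * (β q)^2
      + K * (h q)^3 * Γ (η q / h q)) p w =
    fderiv ℝ h p w * (g * h p + g * b p + (1/2) * (∑ i, (v p i)^2) + (1/6) * (ω p)^2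
      + (1/8) * (β p)^2 + 3 * K * (h p)^2 * Γ (η p / h p) - K * h p * η p * deriv Γ (η p / h p))
    + g * h p * fderiv ℝ b p w
    + h p * (∑ i, v p i * fderiv ℝ (fun q => v q i) p w)
    + (1/3) * h p * ω p * fderiv ℝ ω p w + (1/4) * h p * β p * fderiv ℝ β p w
    + K * (h p)^2 * deriv Γ (η p / h p) * fderiv ℝ η p w := by
  have hne : h p ≠ 0 := hpos.ne'
  have hdiff : DifferentiableAt ℝ (fun q => (1/2) * g * (h q)^2 + g * h q * b q
      + (1/2) * h q * (∑ i, (v q i)^2) + (1/6) * h q * (ω q)^2 + (1/8) * h q * (β q)^2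
      + K * (h q)^3 * Γ (η q / h q)) p := by
    have hquot : DifferentiableAt ℝ (fun q => Γ (η q / h q)) p :=
      (hΓ _).comp p (differentiableAt_quotient hη hh hne)
    have hsq : DifferentiableAt ℝ (fun q => ∑ i, (v q i)^2) p :=
      DifferentiableAt.fun_sum fun i _ => (hv i).fun_pow 2
    fun_prop
  refine ⟨hdiff, ?_⟩
  have lh := hasDerivAt_line w hh
  have lb := hasDerivAt_line w hb
  have lω := hasDerivAt_line w hω
  have lβ := hasDerivAt_line w hβ
  have lη := hasDerivAt_line w hη
  have lv : HasDerivAt (fun s : ℝ => ∑ i, (v (p + s • w) i)^2)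
      (2 * ∑ i, v p i * fderiv ℝ (fun q => v q i) p w) 0 := by
    have := HasDerivAt.fun_sum (u := Finset.univ)
      fun i _ => (hasDerivAt_line w (hv i)).fun_pow 2
    refine this.congr_deriv ?_
    rw [Finset.mul_sum]
    refine Finset.sum_congr rfl fun i _ => ?_
    simp
    ring
  have lquot : HasDerivAt (fun s : ℝ => η (p + s • w) / h (p + s • w))
      ((fderiv ℝ η p w * h p - η p * fderiv ℝ h p w) / (h p)^2) 0 := by
    simpa using lη.fun_div lh (by simpa using hne)
  have lΓ : HasDerivAt (fun s : ℝ => Γ (η (p + s • w) / h (p + s • w)))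
      (deriv Γ (η p / h p)
        * ((fderiv ℝ η p w * h p - η p * fderiv ℝ h p w) / (h p)^2)) 0 := by
    refine HasDerivAt.comp (h₂ := Γ) 0 ?_ lquot
    simpa using (hΓ (η p / h p)).hasDerivAt
  have lE := ((((((lh.fun_pow 2).const_mul ((1/2) * g)).fun_add
    ((lh.const_mul g).fun_mul lb)).fun_add ((lh.const_mul (1/2)).fun_mul lv)).fun_add
    ((lh.const_mul (1/6)).fun_mul (lω.fun_pow 2))).fun_add
    ((lh.const_mul (1/8)).fun_mul (lβ.fun_pow 2))).fun_add
    (((lh.fun_pow 3).const_mul K).fun_mul lΓ)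
  rw [(hasDerivAt_line w hdiff).unique lE]
  simp
  field_simp
  ring

/-- Energy balance for the relaxed Serre--Green--Naghdi system:
`∂_t E_ε + div F_ε = (1/4) ts_ε (β - v·∇z) ≤ 0`. -/
theorem relaxed_sgn_energy_balance
    {d : ℕ} (g h₀ ε lam : ℝ) (hg : 0 < g) (hh₀ : 0 < h₀) (hε : 0 < ε) (hlam : 0 < lam)
    (z : Spc d → ℝ) (zsm : ContDiff ℝ (⊤ : ℕ∞) z)
    -- relaxation functions `Γ` and `Φ`
    (Γ : ℝ → ℝ) (hΓsm : ContDiff ℝ 2 Γ) (hΓnonneg : ∀ x, 0 ≤ Γ x)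
    (hΓ1 : Γ 1 = 0) (hΓ'1 : deriv Γ 1 = 0)
    (Φ : ℝ → ℝ) (hΦcont : Continuous Φ) (hΦsign : ∀ ξ : ℝ, 0 ≤ ξ * Φ ξ)
    -- the unknowns
    (h : SpT d → ℝ) (Q : SpT d → Spc d) (q₁ q₂ q₃ : SpT d → ℝ)
    (hsm : ContDiff ℝ (⊤ : ℕ∞) h) (Qsm : ContDiff ℝ (⊤ : ℕ∞) Q)
    (q₁sm : ContDiff ℝ (⊤ : ℕ∞) q₁) (q₂sm : ContDiff ℝ (⊤ : ℕ∞) q₂) (q₃sm : ContDiff ℝ (⊤ : ℕ∞) q₃)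
    (hpos : ∀ p : SpT d, 0 < h p)
    (v : SpT d → Spc d) (hv : ∀ p, v p = (h p)⁻¹ • Q p)
    (η ω β : SpT d → ℝ)
    (hη : ∀ p, η p = q₁ p / h p) (hω : ∀ p, ω p = q₂ p / h p) (hβ : ∀ p, β p = q₃ p / h p)
    -- relaxation sources and relaxed pressure
    (sε tsε tpε pε rε : SpT d → ℝ)
    (hsε : ∀ p, sε p = lam * g * ((h p)^2 / ε) * deriv Γ (η p / h p))
    (htsε : ∀ p, tsε p = lam * g * h₀ * (h p / ε) * Φ ((advZ v z p - β p) / Real.sqrt (g * h₀)))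
    (htpε : ∀ p, tpε p = -(1/3) * (lam * g / ε) * (h p)^2
        * (η p * deriv Γ (η p / h p) - 2 * h p * Γ (η p / h p)))
    (hpε : ∀ p, pε p = (1/2) * g * (h p)^2 + tpε p)
    (hrε : ∀ p, rε p = g * h p - (1/2) * sε p + (1/4) * tsε p)
    -- the relaxed system on `ℝ^d × (0,∞)`
    (mass : ∀ p : SpT d, 0 < p.2 → dT h p + divF Q p = 0)
    (momentum : ∀ p : SpT d, 0 < p.2 → ∀ i : Fin d,
      dT (fun q => Q q i) p + (∑ j, dX j (fun q => v q j * Q q i) p)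
        + dX i pε p + rε p * dZ i z p.1 = 0)
    (eqq₁ : ∀ p : SpT d, 0 < p.2 →
      dT q₁ p + divSV v q₁ p = q₂ p - (3/2) * (∑ i, Q p i * dZ i z p.1))
    (eqq₂ : ∀ p : SpT d, 0 < p.2 → dT q₂ p + divSV v q₂ p = -(sε p))
    (eqq₃ : ∀ p : SpT d, 0 < p.2 → dT q₃ p + divSV v q₃ p = tsε p)
    -- relaxed energy and energy flux
    (Eε : SpT d → ℝ)
    (hEε : ∀ p, Eε p = (1/2) * g * (h p + z p.1)^2 + (1/2) * h p * (∑ i, (v p i)^2)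
      + (1/6) * h p * (ω p)^2 + (1/8) * h p * (β p)^2
      + (lam * g / (3 * ε)) * (h p)^3 * Γ (η p / h p))
    (Fε : SpT d → Spc d)
    (hFε : ∀ p, ∀ i : Fin d, Fε p i = v p i * (Eε p - (1/2) * g * (z p.1)^2 + pε p)) :
    ∀ p : SpT d, 0 < p.2 →
      dT Eε p + divF Fε p = (1/4) * tsε p * (β p - advZ v z p) ∧
      (1/4) * tsε p * (β p - advZ v z p) ≤ 0 := by
  intro p hp
  have hne : ∀ q, h q ≠ 0 := fun q => (hpos q).ne'
  have top_ne : ((⊤ : ℕ∞) : WithTop ℕ∞) ≠ 0 := by simp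
  have dh : Differentiable ℝ h := hsm.differentiable top_ne
  have dQ : ∀ i, Differentiable ℝ (fun q => Q q i) := fun i =>
    (EuclideanSpace.proj (𝕜 := ℝ) i).differentiable.comp (Qsm.differentiable top_ne)
  have hvQ : ∀ q i, v q i = Q q i / h q := fun q i => by
    rw [hv q, PiLp.smul_apply, smul_eq_mul]
    ring
  have dv : ∀ i, Differentiable ℝ (fun q => v q i) := fun i => by
    simp only [hvQ]
    exact fun q => differentiableAt_quotient (dQ i q) (dh q) (hne q)
  have dη : Differentiable ℝ η := by
    rw [funext hη]
    exact fun q => differentiableAt_quotient (q₁sm.differentiable top_ne q) (dh q) (hne q)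
  have dω : Differentiable ℝ ω := by
    rw [funext hω]
    exact fun q => differentiableAt_quotient (q₂sm.differentiable top_ne q) (dh q) (hne q)
  have dβ : Differentiable ℝ β := by
    rw [funext hβ]
    exact fun q => differentiableAt_quotient (q₃sm.differentiable top_ne q) (dh q) (hne q)
  have dz : Differentiable ℝ z := zsm.differentiable top_ne
  have db : Differentiable ℝ (fun q : SpT d => z q.1) := dz.comp differentiable_fst
  have dΓ : Differentiable ℝ Γ := hΓsm.differentiable (by simp)
  have dΓ' : Differentiable ℝ (deriv Γ) :=
    ((contDiff_succ_iff_deriv (n := 1)).1 hΓsm).2.2.differentiable (by simp)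
  have dquot : Differentiable ℝ (fun q => η q / h q) := fun q =>
    differentiableAt_quotient (dη q) (dh q) (hne q)
  have dpε : Differentiable ℝ pε := by
    have h1 : Differentiable ℝ (fun q => Γ (η q / h q)) := dΓ.comp dquot
    have h2 : Differentiable ℝ (fun q => deriv Γ (η q / h q)) := dΓ'.comp dquot
    rw [funext hpε]
    simp only [htpε]
    fun_prop
  -- the equations in terms of the material derivative
  have hQv : ∀ q i, Q q i = h q * v q i := fun q i => by
    rw [hvQ]
    field_simp [hne q]
  have transport : ∀ f : SpT d → ℝ, DifferentiableAt ℝ f p →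
      dT f p + divSV v f p = fderiv ℝ f p (v p, 1) + f p * divF v p := fun f hf =>
    dT_add_divSV (fun i => dv i p) hf
  have mass' : fderiv ℝ h p (v p, 1) + h p * divF v p = 0 := by
    rw [← transport h (dh p), ← mass p hp]
    simp only [divSV, divF, hQv, mul_comm]
  have material : ∀ a : SpT d → ℝ, DifferentiableAt ℝ a p →
      dT (fun q => h q * a q) p + divSV v (fun q => h q * a q) p
        = h p * fderiv ℝ a p (v p, 1) := fun a ha => by
    rw [transport _ ((dh p).fun_mul ha), fderiv_mul_apply _ (dh p) ha]
    linear_combination a p * mass'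
  have hq₁ : q₁ = fun q => h q * η q := funext fun q => by rw [hη]; field_simp [hne q]
  have hq₂ : q₂ = fun q => h q * ω q := funext fun q => by rw [hω]; field_simp [hne q]
  have hq₃ : q₃ = fun q => h q * β q := funext fun q => by rw [hβ]; field_simp [hne q]
  have evη : fderiv ℝ η p (v p, 1) = ω p - (3/2) * advZ v z p := by
    have e := eqq₁ p hp
    rw [hq₁, material η (dη p), hq₂] at e
    have hadv : ∑ i, Q p i * dZ i z p.1 = h p * advZ v z p := by
      simp only [advZ, Finset.mul_sum, hQv, mul_assoc]
    rw [hadv] at e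
    exact mul_left_cancel₀ (hne p) (by linear_combination e)
  have evω : h p * fderiv ℝ ω p (v p, 1) = -(sε p) := by
    rw [← material ω (dω p), ← hq₂, eqq₂ p hp]
  have evβ : h p * fderiv ℝ β p (v p, 1) = tsε p := by
    rw [← material β (dβ p), ← hq₃, eqq₃ p hp]
  have evv : h p * (∑ i, v p i * fderiv ℝ (fun q => v q i) p (v p, 1))
      = -adv v pε p - rε p * advZ v z p := by
    rw [adv, advZ, Finset.mul_sum, Finset.mul_sum, ← Finset.sum_neg_distrib,
      ← Finset.sum_sub_distrib]
    refine Finset.sum_congr rfl fun i _ => ?_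
    have e := momentum p hp i
    simp only [hQv] at e
    have m := material (fun q => v q i) (dv i p)
    rw [divSV] at m
    linear_combination v p i * e - v p i * m
  -- the energy without its purely topographic part
  obtain ⟨dA, eA⟩ := fderiv_energy (g := g) (K := lam * g / (3 * ε)) (b := fun q => z q.1)
    (v p, 1) dΓ (hpos p) (dh p) (dω p) (dβ p) (dη p) (db p) (fun i => dv i p)
  set A : SpT d → ℝ := fun q => (1/2) * g * (h q)^2 + g * h q * z q.1
      + (1/2) * h q * (∑ i, (v q i)^2) + (1/6) * h q * (ω q)^2 + (1/8) * h q * (β q)^2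
      + (lam * g / (3 * ε)) * (h q)^3 * Γ (η q / h q) with hA
  have hEA : ∀ q, Eε q = A q + (1/2) * g * (z q.1)^2 := fun q => by
    rw [hEε, hA]
    ring
  have dTE : dT Eε p = dT A p := by
    rw [dT, dT, funext fun t => hEA (p.1, t)]
    exact deriv_add_const (f := fun t => A (p.1, t)) ((1/2) * g * (z p.1)^2)
  have divFlux : divF Fε p = divSV v A p + adv v pε p + pε p * divF v p := by
    have hflux : divF Fε p = divSV v (fun q => A q + pε q) p := by
      simp only [divF, divSV, hFε, hEA, add_sub_cancel_right]
    have hadd : adv v (fun q => A q + pε q) p = adv v A p + adv v pε p := by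
      simp only [adv, ← Finset.sum_add_distrib]
      refine Finset.sum_congr rfl fun i _ => ?_
      rw [dX_eq_fderiv i (dA.fun_add (dpε p)), dX_eq_fderiv i dA, dX_eq_fderiv i (dpε p),
        fderiv_fun_add dA (dpε p), add_apply]
      ring
    rw [hflux, divSV_eq (fun i => dv i p) (dA.fun_add (dpε p)), hadd,
      divSV_eq (fun i => dv i p) dA]
    ring
  constructor
  · have hz := fderiv_bathymetry (v := v) (dz p.1)
    have tA := transport A dA
    rw [eA, hz, evη] at tA
    have hAp : A p = (1/2) * g * (h p)^2 + g * h p * z p.1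
      + (1/2) * h p * (∑ i, (v p i)^2) + (1/6) * h p * (ω p)^2 + (1/8) * h p * (β p)^2
      + (lam * g / (3 * ε)) * (h p)^3 * Γ (η p / h p) := rfl
    have hs : sε p = 3 * (lam * g / (3 * ε)) * (h p)^2 * deriv Γ (η p / h p) := by
      rw [hsε]
      field_simp
    have hpr : pε p = (1/2) * g * (h p)^2 - (lam * g / (3 * ε)) * (h p)^2
        * (η p * deriv Γ (η p / h p) - 2 * h p * Γ (η p / h p)) := by
      rw [hpε, htpε]
      field_simp
      ring
    rw [hrε] at evv
    rw [dTE, divFlux]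
    rw [hAp] at tA
    rw [hs] at evω evv
    rw [hpr]
    linear_combination tA + evv + (1/3) * ω p * evω + (1/4) * β p * evβ
      + (g * h p + g * z p.1 + (1/2) * (∑ i, (v p i)^2) + (1/6) * (ω p)^2
      + (1/8) * (β p)^2 + 3 * (lam * g / (3 * ε)) * (h p)^2 * Γ (η p / h p)
      - (lam * g / (3 * ε)) * h p * η p * deriv Γ (η p / h p)) * mass'
  · have hroot : 0 < Real.sqrt (g * h₀) := Real.sqrt_pos.2 (mul_pos hg hh₀)
    have hdrift : β p - advZ v z p = -(Real.sqrt (g * h₀)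
        * ((advZ v z p - β p) / Real.sqrt (g * h₀))) := by
      field_simp
      ring
    have hcoef : 0 ≤ (1/4) * (lam * g * h₀ * (h p / ε)) * Real.sqrt (g * h₀) := by
      have := hpos p
      positivity
    have hnonneg := mul_nonneg hcoef (hΦsign ((advZ v z p - β p) / Real.sqrt (g * h₀)))
    rw [htsε, hdrift]
    linarith
end
end
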